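/- (Mixed second derivative of the α-divergence and the Fisher metric) Let λ > 2 and α ∈ [−1,1]. The map (ã, b̃) ↦ D_α(φ̃^{-1}(ã) | φ̃^{-1}(b̃)) on L^λ(μ) × L^λ(μ) admits the mixed second partial Fréchet derivative D₁D₂D_α(φ̃^{-1}|φ̃^{-1})_{ã,b̃}(ũ, ṽ) = −E_μ[ξ_α^{(1)}(ã) ξ_{−α}^{(1)}(b̃) ũ ṽ] for all ũ, ṽ ∈ L^λ(μ). In particular, on the diagonal b̃ = ã, writing p = ψ(ã), this equals −E_μ[(p/(1+p)²) ũ ṽ], independently of α. -/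

import Mathlib

open MeasureTheory Real Set

section RealFunctions

theorem continuous_of_abs_sub_le {f : ℝ → ℝ} {K : ℝ}
    (hK : ∀ z w, |f w - f z| ≤ K * |w - z|) : Continuous f := by
  refine (LipschitzWith.of_dist_le_mul (K := K.toNNReal) fun x y => ?_).continuous
  rw [Real.dist_eq, Real.dist_eq]
  exact (hK y x).trans (mul_le_mul_of_nonneg_right (Real.le_coe_toNNReal K) (abs_nonneg _))

theorem abs_sub_le_of_hasDerivAt_of_abs_le {f f' : ℝ → ℝ} {K : ℝ}
    (hf : ∀ z, HasDerivAt f (f' z) z) (hK : ∀ z, |f' z| ≤ K) (z w : ℝ) :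
    |f w - f z| ≤ K * |w - z| :=
  convex_univ.norm_image_sub_le_of_norm_hasDerivWithin_le
    (fun x _ => (hf x).hasDerivWithinAt) (fun x _ => hK x) (mem_univ z) (mem_univ w)

/-- First order Taylor bound for a function with Lipschitz derivative. -/
theorem abs_taylor_remainder_le_sq {f f' : ℝ → ℝ} {K : ℝ} (hK0 : 0 ≤ K)
    (hf : ∀ z, HasDerivAt f (f' z) z) (hK : ∀ z w, |f' w - f' z| ≤ K * |w - z|) (z w : ℝ) :
    |f w - f z - f' z * (w - z)| ≤ K * |w - z| ^ 2 := by
  have h := (convex_uIcc z w).norm_image_sub_le_of_norm_hasDerivWithin_le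
    (f := fun y => f y - f' z * y) (f' := fun y => f' y - f' z) (C := K * |w - z|)
    (fun x _ => by
      have h := (hf x).sub ((hasDerivAt_id x).const_mul (f' z))
      rw [mul_one] at h
      exact h.hasDerivWithinAt)
    (fun x hx => (hK z x).trans
      (mul_le_mul_of_nonneg_left (abs_sub_left_of_mem_uIcc hx) hK0))
    left_mem_uIcc right_mem_uIcc
  simp only [Real.norm_eq_abs] at h
  calc _ = |f w - f' z * w - (f z - f' z * z)| := by congr 1; ring
    _ ≤ _ := h
    _ = _ := by ring

theorem abs_taylor_remainder_le_rpow {f f' : ℝ → ℝ} {K s : ℝ} (hs1 : 1 ≤ s) (hs2 : s ≤ 2)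
    (hK2 : 2 ≤ K) (hf : ∀ z, HasDerivAt f (f' z) z)
    (hK : ∀ z w, |f' w - f' z| ≤ K * |w - z|) (hb : ∀ z, |f' z| ≤ 1) (z w : ℝ) :
    |f w - f z - f' z * (w - z)| ≤ K * |w - z| ^ s := by
  rcases le_total |w - z| 1 with h | h
  · refine (abs_taylor_remainder_le_sq (by linarith) hf hK z w).trans ?_
    have := Real.rpow_le_rpow_of_exponent_ge_of_imp (abs_nonneg (w - z)) h hs2 (by intros; linarith)
    rw [Real.rpow_two] at this
    exact mul_le_mul_of_nonneg_left this (by linarith)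
  · have h1 := abs_sub_le_of_hasDerivAt_of_abs_le hf hb z w
    have h2 : |f' z * (w - z)| ≤ 1 * |w - z| := by
      rw [abs_mul]; exact mul_le_mul_of_nonneg_right (hb z) (abs_nonneg _)
    have h3 := Real.rpow_le_rpow_of_exponent_le h hs1
    rw [Real.rpow_one] at h3
    have h4 := abs_sub (f w - f z) (f' z * (w - z))
    nlinarith [abs_nonneg (w - z)]

end RealFunctions

theorem hasFDerivAt_of_norm_remainder_le_rpow {E F : Type*} [NormedAddCommGroup E]
    [NormedSpace ℝ E] [NormedAddCommGroup F] [NormedSpace ℝ F] {f : E → F} {f' : E →L[ℝ] F}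
    {x : E} {C s : ℝ} (hs : 1 < s)
    (h : ∀ k, ‖f (x + k) - f x - f' k‖ ≤ C * ‖k‖ ^ s) : HasFDerivAt f f' x := by
  rw [hasFDerivAt_iff_isLittleO_nhds_zero]
  have h1 : (fun k => f (x + k) - f x - f' k) =O[nhds 0] fun k : E => ‖k‖ ^ s :=
    Asymptotics.IsBigO.of_bound C (Filter.Eventually.of_forall fun k => by
      rw [Real.norm_of_nonneg (Real.rpow_nonneg (norm_nonneg k) s)]; exact h k)
  refine h1.trans_isLittleO ?_
  have h2 : Filter.Tendsto (fun k : E => ‖k‖ ^ (s - 1)) (nhds 0) (nhds 0) := by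
    have : Continuous fun k : E => ‖k‖ ^ (s - 1) :=
      continuous_norm.rpow_const fun _ => Or.inr (by linarith)
    simpa [Real.zero_rpow (by linarith : s - 1 ≠ 0)] using this.tendsto 0
  refine (Asymptotics.isLittleO_of_tendsto' (f := fun k : E => ‖k‖ ^ s) (g := fun k => ‖k‖)
    (Filter.Eventually.of_forall fun k hk => by
      simp [hk, Real.zero_rpow (by linarith : s ≠ 0)]) ?_).norm_right.trans_isBigO
      (Asymptotics.isBigO_norm_left.2 (Asymptotics.isBigO_norm_left.2
        (Asymptotics.isBigO_refl _ _)))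
  refine h2.congr fun k => ?_
  rcases eq_or_ne ‖k‖ 0 with hk | hk
  · simp [hk, Real.zero_rpow (by linarith : s - 1 ≠ 0)]
  · rw [Real.rpow_sub_one hk]

theorem norm_integral_sub_sub_le {X : Type*} [MeasurableSpace X] {μ : Measure X}
    {f g h F : X → ℝ} (hf : Integrable f μ) (hg : Integrable g μ)
    (hh : Integrable h μ) (hF : Integrable F μ) (hle : ∀ᵐ x ∂μ, ‖f x - g x - h x‖ ≤ F x) :
    ‖∫ x, f x ∂μ - ∫ x, g x ∂μ - ∫ x, h x ∂μ‖ ≤ ∫ x, F x ∂μ := by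
  have hfg : Integrable (fun x => f x - g x) μ := hf.sub hg
  rw [← integral_sub hf hg, ← integral_sub hfg hh]
  exact norm_integral_le_of_norm_le hF hle

section Lebesgue

variable {X : Type*} [MeasurableSpace X] {μ : Measure X} [IsProbabilityMeasure μ] {lam : ℝ}

theorem integrable_rpow_abs_mul_abs_and_integral_le (hlam : 2 < lam) {s : ℝ} (hs : 1 ≤ s)
    (hsl : s ≤ lam - 1) {h v : X → ℝ} (hh : MemLp h (ENNReal.ofReal lam) μ)
    (hv : MemLp v (ENNReal.ofReal lam) μ) :
    Integrable (fun x => |h x| ^ s * |v x|) μ ∧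
      ∫ x, |h x| ^ s * |v x| ∂μ ≤
        (eLpNorm h (ENNReal.ofReal lam) μ).toReal ^ s *
          (eLpNorm v (ENNReal.ofReal lam) μ).toReal := by
  set p := ENNReal.ofReal lam with hp
  set q := ENNReal.ofReal (lam / (lam - 1)) with hq
  have hpq : q.HolderConjugate p := by
    have h1 : lam.HolderConjugate (lam / (lam - 1)) :=
      Real.HolderConjugate.conjExponent (by linarith)
    exact h1.symm.ennrealOfReal
  have hqs : q * ENNReal.ofReal s ≤ p := by
    rw [hq, hp, ← ENNReal.ofReal_mul (by apply div_nonneg <;> linarith)]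
    apply ENNReal.ofReal_le_ofReal
    rw [div_mul_eq_mul_div, div_le_iff₀ (by linarith)]
    nlinarith
  have hf_meas : AEStronglyMeasurable (fun x => ‖h x‖ ^ s) μ :=
    (hh.1.norm.aemeasurable.pow_const s).aestronglyMeasurable
  have hfq : eLpNorm (fun x => ‖h x‖ ^ s) q μ ≤ eLpNorm h p μ ^ s := by
    rw [eLpNorm_norm_rpow h (by linarith)]
    exact ENNReal.rpow_le_rpow (eLpNorm_le_eLpNorm_of_exponent_le hqs hh.1) (by linarith)
  have hfin : eLpNorm h p μ ^ s ≠ ⊤ := ENNReal.rpow_ne_top_of_nonneg (by linarith) hh.2.ne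
  have hle : eLpNorm (fun x => |h x| ^ s * |v x|) 1 μ ≤ eLpNorm h p μ ^ s * eLpNorm v p μ := by
    have := eLpNorm_smul_le_mul_eLpNorm (p := q) (q := p) (r := 1) hv.1.norm hf_meas
    rw [eLpNorm_norm] at this
    exact this.trans (mul_le_mul_left hfq _)
  have hmeas : AEStronglyMeasurable (fun x => |h x| ^ s * |v x|) μ := hf_meas.mul hv.1.norm
  have hint : Integrable (fun x => |h x| ^ s * |v x|) μ :=
    memLp_one_iff_integrable.1 ⟨hmeas, hle.trans_lt (ENNReal.mul_lt_top hfin.lt_top hv.2)⟩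
  refine ⟨hint, ?_⟩
  have h2 : ∫ x, |h x| ^ s * |v x| ∂μ = (eLpNorm (fun x => |h x| ^ s * |v x|) 1 μ).toReal := by
    rw [eLpNorm_one_eq_lintegral_enorm, ← integral_norm_eq_lintegral_enorm hmeas]
    refine integral_congr_ae (Filter.Eventually.of_forall fun x => ?_)
    exact (Real.norm_of_nonneg (mul_nonneg (Real.rpow_nonneg (abs_nonneg _) _) (abs_nonneg _))).symm
  rw [h2, ENNReal.toReal_rpow, ← ENNReal.toReal_mul]
  exact ENNReal.toReal_mono (ENNReal.mul_ne_top hfin hv.2.ne) hle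

theorem integrable_mul_mul_of_abs_le (hlam : 2 < lam) {m u v : X → ℝ}
    (hm : AEStronglyMeasurable m μ) (hm1 : ∀ x, |m x| ≤ 1)
    (hu : MemLp u (ENNReal.ofReal lam) μ) (hv : MemLp v (ENNReal.ofReal lam) μ) :
    Integrable (fun x => m x * u x * v x) μ := by
  refine (integrable_rpow_abs_mul_abs_and_integral_le hlam le_rfl (by linarith) hu hv).1.mono'
    ((hm.mul hu.1).mul hv.1) (Filter.Eventually.of_forall fun x => ?_)
  rw [Real.rpow_one, Real.norm_eq_abs, abs_mul, abs_mul, mul_assoc]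
  exact mul_le_of_le_one_left (by positivity) (hm1 x)

theorem exists_clm₂_integral_mul_mul (hlam : 2 < lam) [Fact (1 ≤ ENNReal.ofReal lam)] {m : X → ℝ}
    (hm : AEStronglyMeasurable m μ) (hm1 : ∀ x, |m x| ≤ 1) :
    ∃ B : Lp ℝ (ENNReal.ofReal lam) μ →L[ℝ] Lp ℝ (ENNReal.ofReal lam) μ →L[ℝ] ℝ,
      ∀ u v, B u v = ∫ x, m x * u x * v x ∂μ := by
  have hint (u v : Lp ℝ (ENNReal.ofReal lam) μ) : Integrable (fun x => m x * u x * v x) μ :=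
    integrable_mul_mul_of_abs_le hlam hm hm1 (Lp.memLp u) (Lp.memLp v)
  refine ⟨(LinearMap.mk₂ ℝ (fun u v : Lp ℝ (ENNReal.ofReal lam) μ => ∫ x, m x * u x * v x ∂μ)
    ?_ ?_ ?_ ?_).mkContinuous₂ 1 ?_, fun u v => rfl⟩
  · intro u₁ u₂ v
    rw [← integral_add (hint _ _) (hint _ _)]
    refine integral_congr_ae ?_
    filter_upwards [Lp.coeFn_add u₁ u₂] with x hx
    simp only [hx, Pi.add_apply]; ring
  · intro c u v
    rw [smul_eq_mul, ← integral_const_mul]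
    refine integral_congr_ae ?_
    filter_upwards [Lp.coeFn_smul c u] with x hx
    simp only [hx, Pi.smul_apply, smul_eq_mul]; ring
  · intro u v₁ v₂
    rw [← integral_add (hint _ _) (hint _ _)]
    refine integral_congr_ae ?_
    filter_upwards [Lp.coeFn_add v₁ v₂] with x hx
    simp only [hx, Pi.add_apply]; ring
  · intro c u v
    rw [smul_eq_mul, ← integral_const_mul]
    refine integral_congr_ae ?_
    filter_upwards [Lp.coeFn_smul c v] with x hx
    simp only [hx, Pi.smul_apply, smul_eq_mul]; ring
  · intro u v
    have h := integrable_rpow_abs_mul_abs_and_integral_le hlam le_rfl (by linarith)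
      (Lp.memLp u) (Lp.memLp v)
    simp only [Real.rpow_one] at h
    rw [one_mul, LinearMap.mk₂_apply, Lp.norm_def, Lp.norm_def]
    refine (norm_integral_le_of_norm_le h.1 (Filter.Eventually.of_forall fun x => ?_)).trans h.2
    rw [Real.norm_eq_abs, abs_mul, abs_mul, mul_assoc]
    exact mul_le_of_le_one_left (by positivity) (hm1 x)

theorem MemLp.comp_of_lipschitz {p : ENNReal} {g : ℝ → ℝ} {K : ℝ}
    (hK : ∀ z w, |g w - g z| ≤ K * |w - z|) {a : X → ℝ} (ha : MemLp a p μ) :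
    MemLp (fun x => g (a x)) p μ := by
  have hg : Continuous g := continuous_of_abs_sub_le hK
  have h1 : MemLp (fun x => g (a x) - g 0) p μ :=
    ha.of_le_mul ((hg.comp_aestronglyMeasurable ha.1).sub aestronglyMeasurable_const)
      (Filter.Eventually.of_forall fun x => by simpa using hK 0 (a x))
  have h2 := h1.add (memLp_const (g 0))
  exact h2.ae_eq (Filter.Eventually.of_forall fun x => sub_add_cancel _ _)

/-- A `C¹` function with bounded Lipschitz derivative induces a differentiable superposition
operator from `Lᵖ`, `p > 2`, to its dual. -/
theorem hasFDerivAt_superposition (hlam : 2 < lam) [Fact (1 ≤ ENNReal.ofReal lam)] {m : X → ℝ}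
    (hm : AEStronglyMeasurable m μ) (hm1 : ∀ x, |m x| ≤ 1) {g g' : ℝ → ℝ} {K : ℝ} (hK2 : 2 ≤ K)
    (hg : ∀ z, HasDerivAt g (g' z) z) (hK : ∀ z w, |g' w - g' z| ≤ K * |w - z|)
    (hb : ∀ z, |g' z| ≤ 1)
    {N : Lp ℝ (ENNReal.ofReal lam) μ → Lp ℝ (ENNReal.ofReal lam) μ →L[ℝ] ℝ}
    (hN : ∀ b u, N b u = ∫ x, m x * g (b x) * u x ∂μ) {b : Lp ℝ (ENNReal.ofReal lam) μ}
    {N' : Lp ℝ (ENNReal.ofReal lam) μ →L[ℝ] Lp ℝ (ENNReal.ofReal lam) μ →L[ℝ] ℝ}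
    (hN' : ∀ v u, N' v u = ∫ x, (m x * g' (b x)) * v x * u x ∂μ) : HasFDerivAt N N' b := by
  have hs : 1 < min (lam - 1) 2 := lt_min (by linarith) (by norm_num)
  refine hasFDerivAt_of_norm_remainder_le_rpow (C := K) hs fun k => ?_
  refine ContinuousLinearMap.opNorm_le_bound _ (by positivity) fun u => ?_
  have hg'c : Continuous g' := continuous_of_abs_sub_le hK
  have hgL := abs_sub_le_of_hasDerivAt_of_abs_le hg hb
  have h := integrable_rpow_abs_mul_abs_and_integral_le hlam hs.le (min_le_left _ _)
      (Lp.memLp k) (Lp.memLp u)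
  have hi (c : Lp ℝ (ENNReal.ofReal lam) μ) : Integrable (fun x => m x * g (c x) * u x) μ :=
    integrable_mul_mul_of_abs_le hlam hm hm1 (MemLp.comp_of_lipschitz hgL (Lp.memLp c))
      (Lp.memLp u)
  have hi' : Integrable (fun x => (m x * g' (b x)) * k x * u x) μ := by
    refine integrable_mul_mul_of_abs_le hlam
      (hm.mul (hg'c.comp_aestronglyMeasurable (Lp.memLp b).1)) (fun x => ?_)
      (Lp.memLp k) (Lp.memLp u)
    rw [abs_mul]
    exact mul_le_one₀ (hm1 x) (abs_nonneg _) (hb _)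
  simp only [_root_.sub_apply, hN, hN']
  rw [mul_assoc, Lp.norm_def, Lp.norm_def]
  refine (norm_integral_sub_sub_le (hi _) (hi _) hi' (h.1.const_mul K) ?_).trans
    ((integral_const_mul _ _).trans_le (mul_le_mul_of_nonneg_left h.2 (by linarith)))
  filter_upwards [Lp.coeFn_add b k] with x hx
  have hT := abs_taylor_remainder_le_rpow hs.le (min_le_right _ _) hK2 hg hK hb (b x) (b x + k x)
  rw [add_sub_cancel_left] at hT
  simp only [hx, Pi.add_apply]
  calc _ = |m x| * |g (b x + k x) - g (b x) - g' (b x) * k x| * |u x| := by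
        rw [← abs_mul, ← abs_mul, Real.norm_eq_abs]; congr 1; ring
    _ ≤ 1 * (K * |k x| ^ min (lam - 1) 2) * |u x| := by
        gcongr; exact hm1 x
    _ = _ := by ring

theorem integrable_comp_of_lipschitz_deriv (hlam : 2 < lam)
    {f f' : ℝ → ℝ} {K : ℝ} (hK0 : 0 ≤ K)
    (hf : ∀ z, HasDerivAt f (f' z) z) (hK : ∀ z w, |f' w - f' z| ≤ K * |w - z|)
    {a : X → ℝ} (ha : MemLp a (ENNReal.ofReal lam) μ) : Integrable (fun x => f (a x)) μ := by
  have hfc : Continuous f := continuous_iff_continuousAt.2 fun z => (hf z).continuousAt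
  have h := (integrable_rpow_abs_mul_abs_and_integral_le hlam le_rfl (by linarith) ha ha).1
  have h1 : Integrable a μ := ha.integrable (by simpa using by linarith)
  refine (((integrable_const |f 0|).add (h1.abs.const_mul |f' 0|)).add (h.const_mul K)).mono'
    (hfc.comp_aestronglyMeasurable ha.1) (Filter.Eventually.of_forall fun x => ?_)
  have h2 := abs_taylor_remainder_le_sq hK0 hf hK 0 (a x)
  simp only [Pi.add_apply, Real.rpow_one, Real.norm_eq_abs, sub_zero] at h2 ⊢
  calc |f (a x)| = |f 0 + f' 0 * a x + (f (a x) - f 0 - f' 0 * a x)| := by congr 1; ring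
    _ ≤ _ := abs_add_three _ _ _
    _ ≤ _ := by rw [abs_mul]; nlinarith

theorem exists_hasFDerivAt_integral_comp (hlam : 2 < lam) [Fact (1 ≤ ENNReal.ofReal lam)]
    {f f' : ℝ → ℝ} {K : ℝ} (hK0 : 0 ≤ K)
    (hf : ∀ z, HasDerivAt f (f' z) z) (hK : ∀ z w, |f' w - f' z| ≤ K * |w - z|)
    (a : Lp ℝ (ENNReal.ofReal lam) μ) :
    ∃ T : Lp ℝ (ENNReal.ofReal lam) μ →L[ℝ] ℝ,
      HasFDerivAt (fun a : Lp ℝ (ENNReal.ofReal lam) μ => ∫ x, f (a x) ∂μ) T a := by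
  have hm : AEStronglyMeasurable (fun _ : X => (1 : ℝ)) μ := aestronglyMeasurable_const
  have hm1 : ∀ _ : X, |(1 : ℝ)| ≤ 1 := fun _ => by simp
  obtain ⟨B, hB⟩ := exists_clm₂_integral_mul_mul (lam := lam) hlam hm hm1
  have hw := MemLp.comp_of_lipschitz hK (Lp.memLp a)
  have hi := fun c : Lp ℝ (ENNReal.ofReal lam) μ =>
    integrable_comp_of_lipschitz_deriv hlam hK0 hf hK (Lp.memLp c)
  refine ⟨B (hw.toLp _), hasFDerivAt_of_norm_remainder_le_rpow (C := K) one_lt_two fun k => ?_⟩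
  have h := integrable_rpow_abs_mul_abs_and_integral_le hlam le_rfl (by linarith)
    (Lp.memLp k) (Lp.memLp k)
  rw [hB]
  refine (norm_integral_sub_sub_le (hi _) (hi _)
    (integrable_mul_mul_of_abs_le hlam hm hm1 (Lp.memLp _) (Lp.memLp k))
    (h.1.const_mul K) ?_).trans
    ((integral_const_mul _ _).trans_le (mul_le_mul_of_nonneg_left (h.2.trans_eq ?_) hK0))
  · filter_upwards [Lp.coeFn_add a k, hw.coeFn_toLp] with x hx hx'
    have hT := abs_taylor_remainder_le_sq hK0 hf hK (a x) (a x + k x)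
    rw [add_sub_cancel_left] at hT
    simp only [hx, hx', Pi.add_apply, one_mul, Real.rpow_one, Real.norm_eq_abs]
    rwa [← sq]
  · rw [Real.rpow_one, Real.rpow_two, ← Lp.norm_def, sq]

end Lebesgue

section InverseChart

variable {ψ : ℝ → ℝ}

theorem hasDerivAt_inverse_add_log (hψ : ∀ z : ℝ, 0 < ψ z ∧ ψ z + Real.log (ψ z) = z) (z : ℝ) :
    HasDerivAt ψ (ψ z / (1 + ψ z)) z := by
  have hle : ∀ z w, z ≤ w → ψ z ≤ ψ w := fun z w hzw => by
    by_contra! hlt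
    have := Real.log_lt_log (hψ w).1 hlt
    linarith [(hψ z).2, (hψ w).2]
  have hlip : ∀ z w, z ≤ w → |ψ w - ψ z| ≤ 1 * |w - z| := fun z w hzw => by
    have h1 := hle z w hzw
    have := Real.log_le_log (hψ z).1 h1
    rw [abs_of_nonneg (sub_nonneg.2 h1), abs_of_nonneg (sub_nonneg.2 hzw)]
    linarith [(hψ z).2, (hψ w).2]
  have hc : Continuous ψ := continuous_of_abs_sub_le (K := 1) fun z w => by
    rcases le_total z w with h | h
    · exact hlip z w h
    · rw [abs_sub_comm, abs_sub_comm w z]; exact hlip w z h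
  have hp := (hψ z).1
  have hd : HasDerivAt (fun y => y + Real.log y) (1 + (ψ z)⁻¹) (ψ z) :=
    (hasDerivAt_id _).add (Real.hasDerivAt_log hp.ne')
  have := hd.of_local_left_inverse hc.continuousAt (by positivity)
    (Filter.Eventually.of_forall fun y => (hψ y).2)
  refine HasDerivAt.congr_deriv (this) ?_
  field_simp
  ring

theorem rpow_div_one_add_le_one {x β : ℝ} (hx : 0 < x) (h0 : 0 ≤ β) (h1 : β ≤ 1) :
    x ^ β / (1 + x) ≤ 1 := by
  rw [div_le_one (by linarith)]
  rcases le_total x 1 with h | h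
  · linarith [Real.rpow_le_one hx.le h h0]
  · have := Real.rpow_le_rpow_of_exponent_le h h1
    rw [Real.rpow_one] at this
    linarith

theorem abs_rpow_div_one_add_le_one (hψ : ∀ z : ℝ, 0 < ψ z ∧ ψ z + Real.log (ψ z) = z) {β : ℝ}
    (h0 : 0 ≤ β) (h1 : β ≤ 1) (z : ℝ) : |ψ z ^ β / (1 + ψ z)| ≤ 1 := by
  have hp := (hψ z).1
  rw [abs_of_nonneg (by positivity)]
  exact rpow_div_one_add_le_one hp h0 h1

theorem abs_rpow_div_one_add_sub_le (hψ : ∀ z : ℝ, 0 < ψ z ∧ ψ z + Real.log (ψ z) = z) {β : ℝ}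
    (h0 : 0 ≤ β) (h1 : β ≤ 1) (z w : ℝ) :
    |ψ w ^ β / (1 + ψ w) - ψ z ^ β / (1 + ψ z)| ≤ 2 * |w - z| := by
  refine abs_sub_le_of_hasDerivAt_of_abs_le (f := fun z => ψ z ^ β / (1 + ψ z))
    (f' := fun z => ψ z ^ β / (1 + ψ z) *
      (β * (1 / (1 + ψ z)) - ψ z / (1 + ψ z) * (1 / (1 + ψ z)))) (fun z => ?_) (fun z => ?_) z w
  · have hp := (hψ z).1
    have hd := hasDerivAt_inverse_add_log hψ z
    refine HasDerivAt.congr_deriv ((hd.rpow_const (p := β) (Or.inl hp.ne')).div (hd.const_add 1) (by positivity)) ?_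
    rw [Real.rpow_sub_one hp.ne']
    field_simp
  · have hp := (hψ z).1
    have hb := abs_rpow_div_one_add_le_one hψ h0 h1 z
    have hi0 : 0 ≤ 1 / (1 + ψ z) := by positivity
    have hi1 : 1 / (1 + ψ z) ≤ 1 := by rw [div_le_one (by linarith)]; linarith
    have hj0 : 0 ≤ ψ z / (1 + ψ z) := by positivity
    have hj1 : ψ z / (1 + ψ z) ≤ 1 := by rw [div_le_one (by linarith)]; linarith
    have h2 : |β * (1 / (1 + ψ z)) - ψ z / (1 + ψ z) * (1 / (1 + ψ z))| ≤ 2 := by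
      rw [abs_le]; constructor <;> nlinarith [mul_nonneg h0 hi0, mul_nonneg hj0 hi0]
    rw [abs_mul]
    nlinarith [abs_nonneg (ψ z ^ β / (1 + ψ z))]

theorem hasDerivAt_alpha_embedding (hψ : ∀ z : ℝ, 0 < ψ z ∧ ψ z + Real.log (ψ z) = z) {β : ℝ}
    {ξ : ℝ → ℝ} (hξ : ∀ z, ξ z = if β = 0 then z - ψ z else β⁻¹ * ψ z ^ β) (z : ℝ) :
    HasDerivAt ξ (ψ z ^ β / (1 + ψ z)) z := by
  have hp := (hψ z).1
  have hd := hasDerivAt_inverse_add_log hψ z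
  rw [funext hξ]
  split_ifs with h
  · refine HasDerivAt.congr_deriv ((hasDerivAt_id z).sub hd) ?_
    rw [h, Real.rpow_zero]
    field_simp
    ring
  · refine HasDerivAt.congr_deriv ((hd.rpow_const (p := β) (Or.inl hp.ne')).const_mul β⁻¹) ?_
    rw [Real.rpow_sub_one hp.ne']
    field_simp

theorem abs_log_mul_div_one_add_sub_le (hψ : ∀ z : ℝ, 0 < ψ z ∧ ψ z + Real.log (ψ z) = z)
    (z w : ℝ) : |Real.log (ψ w) * (ψ w / (1 + ψ w)) - Real.log (ψ z) * (ψ z / (1 + ψ z))| ≤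
      2 * |w - z| := by
  refine abs_sub_le_of_hasDerivAt_of_abs_le (f := fun z => Real.log (ψ z) * (ψ z / (1 + ψ z)))
    (f' := fun z => (ψ z * (1 + ψ z) + ψ z * Real.log (ψ z)) / (1 + ψ z) ^ 3)
    (fun z => ?_) (fun z => ?_) z w
  · have hp := (hψ z).1
    have hd := hasDerivAt_inverse_add_log hψ z
    refine HasDerivAt.congr_deriv ((hd.log hp.ne').mul (hd.div (hd.const_add 1) (by positivity))) ?_
    field_simp
    ring
  · have hp := (hψ z).1
    have hu : Real.log (ψ z) ≤ ψ z := by linarith [Real.log_le_sub_one_of_pos hp]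
    have hl : -1 ≤ ψ z * Real.log (ψ z) := by
      have := Real.one_sub_inv_le_log_of_pos hp
      have h2 := mul_le_mul_of_nonneg_left this hp.le
      rw [mul_sub, mul_inv_cancel₀ hp.ne'] at h2
      linarith
    have hu' := mul_le_mul_of_nonneg_left hu hp.le
    rw [abs_div, abs_of_pos (by positivity : 0 < (1 + ψ z) ^ 3), div_le_iff₀ (by positivity),
      abs_le]
    constructor <;> nlinarith [sq_nonneg (ψ z), pow_pos hp 3]

theorem hasDerivAt_mul_log_sub (hψ : ∀ z : ℝ, 0 < ψ z ∧ ψ z + Real.log (ψ z) = z) (z : ℝ) :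
    HasDerivAt (fun z => ψ z * Real.log (ψ z) - ψ z) (Real.log (ψ z) * (ψ z / (1 + ψ z))) z := by
  have hp := (hψ z).1
  have hd := hasDerivAt_inverse_add_log hψ z
  refine HasDerivAt.congr_deriv ((hd.mul (hd.log hp.ne')).sub hd) ?_
  field_simp
  ring

theorem exists_lipschitz_deriv_combination
    (hψ : ∀ z : ℝ, 0 < ψ z ∧ ψ z + Real.log (ψ z) = z) (c d : ℝ) :
    ∃ (f' : ℝ → ℝ) (K : ℝ), 0 ≤ K ∧
      (∀ z, HasDerivAt (fun z => c * ψ z + d * (ψ z * Real.log (ψ z) - ψ z)) (f' z) z) ∧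
      ∀ z w, |f' w - f' z| ≤ K * |w - z| := by
  refine ⟨_, |c| * 2 + |d| * 2, by positivity, fun z =>
    ((hasDerivAt_inverse_add_log hψ z).const_mul c).add
      ((hasDerivAt_mul_log_sub hψ z).const_mul d), fun z w => ?_⟩
  have h1 := abs_rpow_div_one_add_sub_le hψ zero_le_one le_rfl z w
  simp only [Real.rpow_one] at h1
  have h2 := abs_log_mul_div_one_add_sub_le hψ z w
  calc _ = |c * (ψ w / (1 + ψ w) - ψ z / (1 + ψ z)) +
        d * (Real.log (ψ w) * (ψ w / (1 + ψ w)) - Real.log (ψ z) * (ψ z / (1 + ψ z)))| := by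
        congr 1; ring
    _ ≤ |c| * (2 * |w - z|) + |d| * (2 * |w - z|) := by
        refine (abs_add_le _ _).trans ?_
        rw [abs_mul, abs_mul]
        gcongr
    _ = _ := by ring

/-- The integrand of the `α`-divergence splits into functions of one variable and a product. -/
theorem exists_alpha_divergence_split
    (hψ : ∀ z : ℝ, 0 < ψ z ∧ ψ z + Real.log (ψ z) = z) {α : ℝ}
    {ξa ξb : ℝ → ℝ}
    (hξa : ∀ z : ℝ, ξa z =
      if α = 1 then z - ψ z else (2 / (1 - α)) * ψ z ^ ((1 - α) / 2))
    (hξb : ∀ z : ℝ, ξb z =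
      if α = -1 then z - ψ z else (2 / (1 + α)) * ψ z ^ ((1 + α) / 2)) :
    ∃ c d c' d' : ℝ, ∀ x y : ℝ,
      (if α = -1 then ψ y - ψ x + ψ x * Real.log (ψ x / ψ y)
       else if α = 1 then ψ x - ψ y + ψ y * Real.log (ψ y / ψ x)
       else (2 / (1 + α)) * ψ x + (2 / (1 - α)) * ψ y -
          (4 / (1 - α ^ 2)) * ψ x ^ ((1 - α) / 2) * ψ y ^ ((1 + α) / 2)) =
      (c * ψ x + d * (ψ x * Real.log (ψ x) - ψ x)) +
        (c' * ψ y + d' * (ψ y * Real.log (ψ y) - ψ y)) - ξa x * ξb y := by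
  by_cases h1 : α = -1
  · refine ⟨0, 1, 1, 0, fun x y => ?_⟩
    have hy : y - ψ y = Real.log (ψ y) := by linarith [(hψ y).2]
    rw [hξa, hξb, if_pos h1, if_pos h1, if_neg (by rw [h1]; norm_num), hy,
      Real.log_div (hψ x).1.ne' (hψ y).1.ne', h1]
    norm_num
    ring
  by_cases h2 : α = 1
  · refine ⟨1, 0, 0, 1, fun x y => ?_⟩
    have hx : x - ψ x = Real.log (ψ x) := by linarith [(hψ x).2]
    rw [hξa, hξb, if_neg h1, if_pos h2, if_neg h1, if_pos h2, hx,
      Real.log_div (hψ y).1.ne' (hψ x).1.ne', h2]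
    norm_num
    ring
  · refine ⟨2 / (1 + α), 0, 2 / (1 - α), 0, fun x y => ?_⟩
    have h3 : 1 + α ≠ 0 := fun h => h1 (by linarith)
    have h4 : 1 - α ≠ 0 := fun h => h2 (by linarith)
    have h5 : 4 / (1 - α ^ 2) = 2 / (1 - α) * (2 / (1 + α)) := by
      rw [div_mul_div_comm]; congr 1 <;> ring
    rw [hξa, hξb, if_neg h1, if_neg h2, if_neg h1, if_neg h2, h5]
    ring

end InverseChart

/-- mixed second derivative of the `α`-divergence and the Fisher metric:
for `λ > 2` and `α ∈ [−1,1]`, the chart expression of the `α`-divergence admits the mixed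
second partial Fréchet derivative
`D₁D₂D_α(φ̃^{-1}|φ̃^{-1})_{ã,b̃}(ũ,ṽ) = −E_μ[ξ_α^{(1)}(ã) ξ_{−α}^{(1)}(b̃) ũ ṽ]`, and on
the diagonal `b̃ = ã`, with `p = ψ∘ã`, this equals `−E_μ[(p/(1+p)²) ũ ṽ]`. -/
theorem stmt_16 {X : Type*} [MeasurableSpace X] (μ : Measure X) [IsProbabilityMeasure μ]
    (lam : ℝ) (hlam : 2 < lam) [Fact (1 ≤ ENNReal.ofReal lam)]
    (ψ : ℝ → ℝ) (hψ : ∀ z : ℝ, 0 < ψ z ∧ ψ z + Real.log (ψ z) = z)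
    (α : ℝ) (hα : α ∈ Icc (-1 : ℝ) 1)
    (ξa ξb : ℝ → ℝ)
    (hξa : ∀ z : ℝ, ξa z =
      if α = 1 then z - ψ z else (2 / (1 - α)) * ψ z ^ ((1 - α) / 2))
    (hξb : ∀ z : ℝ, ξb z =
      if α = -1 then z - ψ z else (2 / (1 + α)) * ψ z ^ ((1 + α) / 2))
    (Dv : Lp ℝ (ENNReal.ofReal lam) μ → Lp ℝ (ENNReal.ofReal lam) μ → ℝ)
    (hDv : ∀ a b : Lp ℝ (ENNReal.ofReal lam) μ, Dv a b =
      if α = -1 then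
        ∫ x, (ψ (b x) - ψ (a x) + ψ (a x) * Real.log (ψ (a x) / ψ (b x))) ∂μ
      else if α = 1 then
        ∫ x, (ψ (a x) - ψ (b x) + ψ (b x) * Real.log (ψ (b x) / ψ (a x))) ∂μ
      else
        ∫ x, ((2 / (1 + α)) * ψ (a x) + (2 / (1 - α)) * ψ (b x) -
          (4 / (1 - α ^ 2)) * ψ (a x) ^ ((1 - α) / 2) * ψ (b x) ^ ((1 + α) / 2)) ∂μ) :
    -- D₁ exists
    (∀ b : Lp ℝ (ENNReal.ofReal lam) μ, Differentiable ℝ (fun a => Dv a b)) ∧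
    -- D₁D₂ exists, with the stated formula
    (∀ a b : Lp ℝ (ENNReal.ofReal lam) μ,
      DifferentiableAt ℝ (fun b' => fderiv ℝ (fun a' => Dv a' b') a) b ∧
      ∀ u v : Lp ℝ (ENNReal.ofReal lam) μ,
        fderiv ℝ (fun b' => fderiv ℝ (fun a' => Dv a' b') a) b v u =
          -∫ x, deriv ξa (a x) * deriv ξb (b x) * u x * v x ∂μ) ∧
    -- on the diagonal b̃ = ã this is the Fisher metric, independently of α
    (∀ a : Lp ℝ (ENNReal.ofReal lam) μ, ∀ u v : Lp ℝ (ENNReal.ofReal lam) μ,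
      fderiv ℝ (fun b' => fderiv ℝ (fun a' => Dv a' b') a) a v u =
        -∫ x, (ψ (a x) / (1 + ψ (a x)) ^ 2) * u x * v x ∂μ) := by
  have hα1 : 0 ≤ (1 - α) / 2 := by linarith [hα.2]
  have hα1' : (1 - α) / 2 ≤ 1 := by linarith [hα.1]
  have hα2 : 0 ≤ (1 + α) / 2 := by linarith [hα.1]
  have hα2' : (1 + α) / 2 ≤ 1 := by linarith [hα.2]
  set A : ℝ → ℝ := fun z => ψ z ^ ((1 - α) / 2) / (1 + ψ z) with hA
  set B : ℝ → ℝ := fun z => ψ z ^ ((1 + α) / 2) / (1 + ψ z) with hB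
  have hξa' : ∀ z, HasDerivAt ξa (A z) z := hasDerivAt_alpha_embedding hψ fun z => by
    have : (1 - α) / 2 = 0 ↔ α = 1 := by constructor <;> intro h <;> linarith
    simp only [hξa, this, inv_div]
  have hξb' : ∀ z, HasDerivAt ξb (B z) z := hasDerivAt_alpha_embedding hψ fun z => by
    have : (1 + α) / 2 = 0 ↔ α = -1 := by constructor <;> intro h <;> linarith
    simp only [hξb, this, inv_div]
  have hA1 : ∀ z, |A z| ≤ 1 := abs_rpow_div_one_add_le_one hψ hα1 hα1'
  have hB1 : ∀ z, |B z| ≤ 1 := abs_rpow_div_one_add_le_one hψ hα2 hα2'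
  have hAL : ∀ z w, |A w - A z| ≤ 2 * |w - z| := abs_rpow_div_one_add_sub_le hψ hα1 hα1'
  have hBL : ∀ z w, |B w - B z| ≤ 2 * |w - z| := abs_rpow_div_one_add_sub_le hψ hα2 hα2'
  have hξaL := abs_sub_le_of_hasDerivAt_of_abs_le hξa' hA1
  have hξbL := abs_sub_le_of_hasDerivAt_of_abs_le hξb' hB1
  obtain ⟨c, d, c', d', hsplit⟩ := exists_alpha_divergence_split hψ hξa hξb
  obtain ⟨F', K, hK0, hF, hFL⟩ := exists_lipschitz_deriv_combination hψ c d
  obtain ⟨G', K', hK'0, hG, hGL⟩ := exists_lipschitz_deriv_combination hψ c' d'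
  set F : ℝ → ℝ := fun z => c * ψ z + d * (ψ z * Real.log (ψ z) - ψ z)
  set G : ℝ → ℝ := fun z => c' * ψ z + d' * (ψ z * Real.log (ψ z) - ψ z)
  have hone : AEStronglyMeasurable (fun _ : X => (1 : ℝ)) μ := aestronglyMeasurable_const
  have hone1 : ∀ _ : X, |(1 : ℝ)| ≤ 1 := fun _ => by simp
  have hAm (a : Lp ℝ (ENNReal.ofReal lam) μ) : AEStronglyMeasurable (fun x => A (a x)) μ :=
    (continuous_of_abs_sub_le hAL).comp_aestronglyMeasurable (Lp.memLp a).1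
  have hBm (a : Lp ℝ (ENNReal.ofReal lam) μ) : AEStronglyMeasurable (fun x => B (a x)) μ :=
    (continuous_of_abs_sub_le hBL).comp_aestronglyMeasurable (Lp.memLp a).1
  have hma (a : Lp ℝ (ENNReal.ofReal lam) μ) := MemLp.comp_of_lipschitz hξaL (Lp.memLp a)
  have hmb (b : Lp ℝ (ENNReal.ofReal lam) μ) := MemLp.comp_of_lipschitz hξbL (Lp.memLp b)
  obtain ⟨B₁, hB₁⟩ := exists_clm₂_integral_mul_mul (lam := lam) hlam hone hone1
  have hDsplit (a b : Lp ℝ (ENNReal.ofReal lam) μ) : Dv a b =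
      ∫ x, F (a x) ∂μ + ∫ x, G (b x) ∂μ - B₁ ((hma a).toLp _) ((hmb b).toLp _) := by
    have hiF := integrable_comp_of_lipschitz_deriv hlam hK0 hF hFL (Lp.memLp a)
    have hiG := integrable_comp_of_lipschitz_deriv hlam hK'0 hG hGL (Lp.memLp b)
    have hi := integrable_mul_mul_of_abs_le hlam hone hone1 (hma a) (hmb b)
    have h1 : B₁ ((hma a).toLp _) ((hmb b).toLp _) = ∫ x, 1 * ξa (a x) * ξb (b x) ∂μ := by
      rw [hB₁]
      refine integral_congr_ae ?_
      filter_upwards [(hma a).coeFn_toLp, (hmb b).coeFn_toLp] with x hx hx'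
      rw [hx, hx']
    have hiFG : Integrable (fun x => F (a x) + G (b x)) μ := hiF.add hiG
    rw [h1, ← integral_add hiF hiG, ← integral_sub hiFG hi, hDv]
    have hpt (x : X) := hsplit (a x) (b x)
    simp only [one_mul]
    refine Eq.trans ?_ (integral_congr_ae (Filter.Eventually.of_forall hpt))
    split_ifs <;> rfl
  have hfirst (a : Lp ℝ (ENNReal.ofReal lam) μ) :
      ∃ (T : Lp ℝ (ENNReal.ofReal lam) μ →L[ℝ] ℝ)
        (N : Lp ℝ (ENNReal.ofReal lam) μ → Lp ℝ (ENNReal.ofReal lam) μ →L[ℝ] ℝ),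
        (∀ b u, N b u = ∫ x, A (a x) * ξb (b x) * u x ∂μ) ∧
        ∀ b, HasFDerivAt (fun a' => Dv a' b) (T - N b) a := by
    obtain ⟨T, hT⟩ := exists_hasFDerivAt_integral_comp hlam hK0 hF hFL a
    obtain ⟨B₂, hB₂⟩ := exists_clm₂_integral_mul_mul (lam := lam) hlam (hAm a) (fun x => hA1 (a x))
    have hN (b u : Lp ℝ (ENNReal.ofReal lam) μ) :
        B₂ ((hmb b).toLp _) u = ∫ x, A (a x) * ξb (b x) * u x ∂μ := by
      rw [hB₂]
      refine integral_congr_ae ?_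
      filter_upwards [(hmb b).coeFn_toLp] with x hx
      rw [hx]
    refine ⟨T, fun b => B₂ ((hmb b).toLp _), hN, fun b => ?_⟩
    have hsup := hasFDerivAt_superposition (b := a) (N' := B₂) hlam hone hone1 le_rfl hξa' hAL hA1
      (N := fun a' => B₁ ((hma a').toLp _)) (fun a' u => by
        rw [hB₁]
        refine integral_congr_ae ?_
        filter_upwards [(hma a').coeFn_toLp] with x hx
        rw [hx]) (fun v u => by simp only [hB₂, one_mul])
    have hpair := ((ContinuousLinearMap.apply ℝ ℝ ((hmb b).toLp _)).hasFDerivAt).comp a hsup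
    have heq : (ContinuousLinearMap.apply ℝ ℝ ((hmb b).toLp _)).comp B₂ =
        B₂ ((hmb b).toLp _) := by
      ext u
      change B₂ u _ = _
      rw [hB₂, hB₂]
      exact integral_congr_ae (Filter.Eventually.of_forall fun x => by ring)
    rw [heq] at hpair
    rw [funext fun a' => hDsplit a' b]
    exact (hT.add_const _).sub hpair
  have hsecond (a b : Lp ℝ (ENNReal.ofReal lam) μ) :
      ∃ M : Lp ℝ (ENNReal.ofReal lam) μ →L[ℝ] Lp ℝ (ENNReal.ofReal lam) μ →L[ℝ] ℝ,
        HasFDerivAt (fun b' => fderiv ℝ (fun a' => Dv a' b') a) M b ∧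
        ∀ u v, M v u = -∫ x, A (a x) * B (b x) * u x * v x ∂μ := by
    obtain ⟨T, N, hN, hD⟩ := hfirst a
    obtain ⟨B₃, hB₃⟩ := exists_clm₂_integral_mul_mul (lam := lam) hlam ((hAm a).mul (hBm b))
      (fun x => (abs_mul _ _).trans_le (mul_le_one₀ (hA1 (a x)) (abs_nonneg _) (hB1 (b x))))
    have hsup := hasFDerivAt_superposition (b := b) (N' := B₃) hlam (hAm a) (fun x => hA1 (a x))
      le_rfl hξb' hBL hB1 hN hB₃
    refine ⟨-B₃, ?_, fun u v => ?_⟩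
    · rw [funext fun b' => (hD b').fderiv]
      exact hsup.const_sub T
    · change -(B₃ v u) = _
      rw [hB₃]
      congr 1
      refine integral_congr_ae (Filter.Eventually.of_forall fun x => ?_)
      simp only [Pi.mul_apply]
      ring
  refine ⟨fun b a => ?_, fun a b => ?_, fun a u v => ?_⟩
  · obtain ⟨T, N, -, hD⟩ := hfirst a
    exact (hD b).differentiableAt
  · obtain ⟨M, hM, hMuv⟩ := hsecond a b
    refine ⟨hM.differentiableAt, fun u v => ?_⟩
    simp only [hM.fderiv, hMuv, (hξa' _).deriv, (hξb' _).deriv]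
  · obtain ⟨M, hM, hMuv⟩ := hsecond a a
    rw [hM.fderiv, hMuv]
    congr 1
    refine integral_congr_ae (Filter.Eventually.of_forall fun x => ?_)
    have hp := (hψ (a x)).1
    have h : A (a x) * B (a x) = ψ (a x) / (1 + ψ (a x)) ^ 2 := by
      rw [hA, hB, div_mul_div_comm, ← Real.rpow_add hp, ← sq]
      congr 1
      rw [show (1 - α) / 2 + (1 + α) / 2 = 1 by ring, Real.rpow_one]
    simp only [h]
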